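/- arXiv:math/0504107 — 7 statements merged into one kernel-verified Lean document; each statement's English description precedes it below -/
import Mathlib

section
/- Let n ≥ 1 and let C = (c_{j,i}) be a family of integers indexed by 1 ≤ j < i ≤ n. Then for every i with 1 ≤ i ≤ n, the element y_i − 1 is nilpotent in the Bott ring K_n(C). -/
/-- The `i`-th defining relation of the Bott ring: `(yᵢ - 1) * (yᵢ - ∏_{j<i} yⱼ^{-c_{j,i}})`
inside the Laurent polynomial ring `ℤ[y₁^{±1},…,y_n^{±1}]`, realized as the group algebra
`AddMonoidAlgebra ℤ (Fin n → ℤ)` of `ℤⁿ` over `ℤ`. -/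
noncomputable def bottRel (n : ℕ) (C : Fin n → Fin n → ℤ) (i : Fin n) :
    AddMonoidAlgebra ℤ (Fin n → ℤ) :=
  (AddMonoidAlgebra.single (Pi.single i (1 : ℤ)) (1 : ℤ) - 1) *
  (AddMonoidAlgebra.single (Pi.single i (1 : ℤ)) (1 : ℤ) -
    AddMonoidAlgebra.single (fun j => if j < i then -(C j i) else 0) (1 : ℤ))

/-- The Bott ring `K_n(C)`. -/
noncomputable abbrev BottRing (n : ℕ) (C : Fin n → Fin n → ℤ) :=
  AddMonoidAlgebra ℤ (Fin n → ℤ) ⧸ Ideal.span (Set.range (bottRel n C))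

/-- The class of `yᵢ` in the Bott ring. -/
noncomputable def bottY (n : ℕ) (C : Fin n → Fin n → ℤ) (i : Fin n) : BottRing n C :=
  Ideal.Quotient.mk (Ideal.span (Set.range (bottRel n C)))
    (AddMonoidAlgebra.single (Pi.single i (1 : ℤ)) (1 : ℤ))

/-- The exponents `v` whose monomial maps to a unipotent element under a ring homomorphism `f`
out of a group algebra form a subgroup. -/
def unipotentExponents {G R : Type*} [AddCommGroup G] [CommRing R]
    (f : AddMonoidAlgebra ℤ G →+* R) : AddSubgroup G where
  carrier := {v | IsNilpotent (f (AddMonoidAlgebra.single v 1) - 1)}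
  zero_mem' := by
    have h : f (AddMonoidAlgebra.single 0 1) = 1 := by
      rw [← AddMonoidAlgebra.one_def, map_one]
    simp [h]
  add_mem' := by
    intro v w hv hw
    have h : f (AddMonoidAlgebra.single (v + w) 1) - 1 =
        (f (AddMonoidAlgebra.single v 1) - 1) * f (AddMonoidAlgebra.single w 1) +
          (f (AddMonoidAlgebra.single w 1) - 1) := by
      rw [← mul_one (1 : ℤ), ← AddMonoidAlgebra.single_mul_single, map_mul, mul_one]
      ring
    rw [Set.mem_ofPred_eq, h]
    exact (Commute.all _ _).isNilpotent_add ((Commute.all _ _).isNilpotent_mul_right hv) hw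
  neg_mem' := by
    intro v hv
    have h : f (AddMonoidAlgebra.single v 1) * f (AddMonoidAlgebra.single (-v) 1) = 1 := by
      rw [← map_mul, AddMonoidAlgebra.single_mul_single, add_neg_cancel, mul_one,
        ← AddMonoidAlgebra.one_def, map_one]
    have h' : f (AddMonoidAlgebra.single (-v) 1) - 1 =
        (f (AddMonoidAlgebra.single v 1) - 1) * -f (AddMonoidAlgebra.single (-v) 1) := by
      linear_combination h
    rw [Set.mem_ofPred_eq, h']
    exact (Commute.all _ _).isNilpotent_mul_right hv

/-- If `(y - 1) * (y - m) = 0` and `m` is unipotent, then so is `y`. -/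
lemma isNilpotent_sub_one_of_mul_sub_eq_zero {R : Type*} [CommRing R] {y m : R}
    (h : (y - 1) * (y - m) = 0) (hm : IsNilpotent (m - 1)) : IsNilpotent (y - 1) := by
  have h2 : (y - 1) ^ 2 = (y - 1) * (m - 1) := by linear_combination h
  rw [← IsNilpotent.pow_iff_pos two_ne_zero, h2]
  exact (Commute.all _ _).isNilpotent_mul_left hm

/-- For every `i`, the element `yᵢ - 1` is nilpotent in the Bott ring `K_n(C)`. -/
theorem stmt_1 (n : ℕ) (hn : 1 ≤ n) (C : Fin n → Fin n → ℤ) (i : Fin n) :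
    IsNilpotent (bottY n C i - 1) := by
  induction i using WellFoundedLT.induction with
  | ind i ih =>
    let q := Ideal.Quotient.mk (Ideal.span (Set.range (bottRel n C)))
    have hrel : q (bottRel n C i) = 0 :=
      Ideal.Quotient.eq_zero_iff_mem.mpr (Ideal.subset_span ⟨i, rfl⟩)
    rw [bottRel, map_mul, map_sub, map_sub, map_one] at hrel
    refine isNilpotent_sub_one_of_mul_sub_eq_zero hrel ?_
    change (fun j => if j < i then -(C j i) else 0) ∈ unipotentExponents q
    rw [← Finset.univ_sum_single (fun j => if j < i then -(C j i) else 0)]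
    refine sum_mem fun j _ => ?_
    split_ifs with hj
    · rw [← mul_one (-(C j i)), ← smul_eq_mul, Pi.single_smul]
      exact zsmul_mem (ih j hj) _
    · rw [Pi.single_zero]
      exact zero_mem _
end

section
/- Let n ≥ 1 and let C = (c_{j,i}) be a family of integers indexed by 1 ≤ j < i ≤ n. Then there exists a ring automorphism σ of the Bott ring K_n(C) with σ(y_i) = y_i^{−1} for all 1 ≤ i ≤ n, and σ is an involution, i.e. σ ∘ σ is the identity. -/
/-- The involution of the group algebra sending each group element to its inverse. -/
noncomputable def laurentInv (n : ℕ) :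
    AddMonoidAlgebra ℤ (Fin n → ℤ) →+* AddMonoidAlgebra ℤ (Fin n → ℤ) :=
  AddMonoidAlgebra.mapDomainRingHom ℤ (negAddMonoidHom : (Fin n → ℤ) →+ (Fin n → ℤ))

theorem laurentInv_single (n : ℕ) (a : Fin n → ℤ) (r : ℤ) :
    laurentInv n (AddMonoidAlgebra.single a r) = AddMonoidAlgebra.single (-a) r := by
  simp [laurentInv]

theorem laurentInv_laurentInv (n : ℕ) (x : AddMonoidAlgebra ℤ (Fin n → ℤ)) :
    laurentInv n (laurentInv n x) = x := by
  have h : (laurentInv n).comp (laurentInv n) = RingHom.id _ := by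
    refine AddMonoidAlgebra.ringHom_ext (fun r => ?_) (fun a => ?_) <;>
      simp [laurentInv_single]
  exact RingHom.congr_fun h x

theorem single_neg_mul_single {G : Type*} [AddGroup G] (a : G) :
    AddMonoidAlgebra.single (-a) (1 : ℤ) * AddMonoidAlgebra.single a (1 : ℤ) = 1 := by
  rw [AddMonoidAlgebra.single_mul_single, neg_add_cancel, one_mul, AddMonoidAlgebra.one_def]

theorem laurentInv_bottRel_mem (n : ℕ) (C : Fin n → Fin n → ℤ) (i : Fin n) :
    laurentInv n (bottRel n C i) ∈ Ideal.span (Set.range (bottRel n C)) := by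
  have hrel : bottRel n C i ∈ Ideal.span (Set.range (bottRel n C)) :=
    Ideal.subset_span ⟨i, rfl⟩
  unfold bottRel at hrel ⊢
  simp only [map_mul, map_sub, map_one, laurentInv_single]
  generalize (fun j => if j < i then -(C j i) else 0 : Fin n → ℤ) = m at hrel ⊢
  have hy := single_neg_mul_single (Pi.single i (1 : ℤ) : Fin n → ℤ)
  have hm := single_neg_mul_single m
  generalize AddMonoidAlgebra.single (-Pi.single i (1 : ℤ) : Fin n → ℤ) (1 : ℤ) = y' at *
  generalize AddMonoidAlgebra.single (Pi.single i (1 : ℤ) : Fin n → ℤ) (1 : ℤ) = y at *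
  generalize AddMonoidAlgebra.single (-m) (1 : ℤ) = m' at *
  generalize AddMonoidAlgebra.single m (1 : ℤ) = z at *
  have key : (y' - 1) * (y' - m') = y' * y' * m' * ((y - 1) * (y - z)) := by
    have h1 : y' * (y - 1) = 1 - y' := by rw [mul_sub, hy, mul_one]
    have h2 : y' * m' * (y - z) = m' - y' := by
      linear_combination m' * hy - y' * hm
    linear_combination -(y' * m' * (y - z)) * h1 - (1 - y') * h2
  rw [key]
  exact Ideal.mul_mem_left _ _ hrel

/-- The endomorphism of the Bott ring inverting every `yᵢ`. -/
noncomputable def bottInv (n : ℕ) (C : Fin n → Fin n → ℤ) : BottRing n C →+* BottRing n C :=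
  Ideal.quotientMap _ (laurentInv n) <| by
    rw [Ideal.span_le]
    rintro _ ⟨i, rfl⟩
    exact laurentInv_bottRel_mem n C i

theorem bottInv_bottInv (n : ℕ) (C : Fin n → Fin n → ℤ) (x : BottRing n C) :
    bottInv n C (bottInv n C x) = x := by
  obtain ⟨x, rfl⟩ := Ideal.Quotient.mk_surjective x
  simp only [bottInv, Ideal.quotientMap_mk, laurentInv_laurentInv]

theorem bottInv_bottY_mul (n : ℕ) (C : Fin n → Fin n → ℤ) (i : Fin n) :
    bottInv n C (bottY n C i) * bottY n C i = 1 := by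
  simp only [bottInv, bottY, Ideal.quotientMap_mk]
  rw [← map_mul, laurentInv_single, single_neg_mul_single, map_one]

/-- There exists a ring automorphism `σ` of the Bott ring `K_n(C)` with
`σ(yᵢ) = yᵢ⁻¹` for all `i` (expressed as `σ(yᵢ) * yᵢ = 1`, which says that `σ(yᵢ)` is the
inverse of the unit `yᵢ`), and `σ` is an involution: `σ ∘ σ = id`. -/
theorem stmt_3 (n : ℕ) (hn : 1 ≤ n) (C : Fin n → Fin n → ℤ) :
    ∃ σ : BottRing n C ≃+* BottRing n C,
      (∀ i : Fin n, σ (bottY n C i) * bottY n C i = 1) ∧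
      ∀ x : BottRing n C, σ (σ x) = x := by
  exact ⟨RingEquiv.ofRingHom (bottInv n C) (bottInv n C)
      (RingHom.ext (bottInv_bottInv n C)) (RingHom.ext (bottInv_bottInv n C)),
    bottInv_bottY_mul n C, bottInv_bottInv n C⟩
end

section
/- Let A be a commutative ring and let b ∈ A be a unit. Then the canonical A-algebra homomorphism A[y]/⟨(y − 1)(y − b)⟩ → A[y, y^{−1}]/⟨(y − 1)(y − b)⟩, induced by the inclusion of the polynomial ring A[y] into the Laurent polynomial ring A[y, y^{−1}], is an isomorphism of rings. -/
open Polynomial LaurentPolynomial in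
/-- The map `A[y]/⟨f⟩ → A[y,y⁻¹]/⟨f⟩` induced by the inclusion is bijective whenever `y` is
coprime to `f`. -/
theorem Polynomial.bijective_quotientMap_toLaurent {A : Type*} [CommRing A] {f : A[X]}
    (hf : IsCoprime X f)
    (h : Ideal.span {f} ≤ (Ideal.span {toLaurent f}).comap (toLaurent : A[X] →+* A[T;T⁻¹])) :
    Function.Bijective (Ideal.quotientMap (Ideal.span {toLaurent f}) toLaurent h) := by
  constructor
  · refine Ideal.quotientMap_injective' fun p hp => ?_
    rw [Ideal.mem_comap, Ideal.mem_span_singleton] at hp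
    obtain ⟨q, hq⟩ := hp
    obtain ⟨n, r, hr⟩ := q.exists_T_pow
    rw [Ideal.mem_span_singleton]
    have hX : p * X ^ n = f * r := by
      apply toLaurent_injective
      rw [map_mul, map_mul, toLaurent_X_pow, hq, hr, mul_assoc]
    exact (hf.pow_left (m := n)).symm.dvd_of_dvd_mul_right ⟨r, hX⟩
  · intro x
    obtain ⟨q, rfl⟩ := Ideal.Quotient.mk_surjective x
    obtain ⟨n, p, hp⟩ := q.exists_T_pow
    obtain ⟨a, c, hac⟩ := hf.pow_left (m := n)
    refine ⟨Ideal.Quotient.mk _ (p * a), ?_⟩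
    rw [Ideal.quotientMap_mk, Ideal.Quotient.eq, Ideal.mem_span_singleton]
    refine ⟨-(q * toLaurent c), ?_⟩
    have hL := congrArg toLaurent hac
    simp only [map_add, map_mul, toLaurent_X_pow, map_one] at hL
    rw [map_mul, hp]
    linear_combination q * hL

open Polynomial in
theorem Polynomial.isCoprime_X_mul_X_sub_C {A : Type*} [CommRing A] (b : Aˣ) :
    IsCoprime (X : A[X]) ((X - 1) * (X - C (b : A))) := by
  refine IsCoprime.mul_right ⟨1, -1, by ring⟩ ⟨C (↑b⁻¹ : A), -C (↑b⁻¹ : A), ?_⟩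
  have hb : C (↑b⁻¹ : A) * C (b : A) = 1 := by rw [← C_mul, Units.inv_mul, C_1]
  linear_combination hb

open Polynomial LaurentPolynomial in
/-- For a unit `b` of a commutative ring `A`, the canonical `A`-algebra
homomorphism `A[y]/⟨(y-1)(y-b)⟩ → A[y,y⁻¹]/⟨(y-1)(y-b)⟩` induced by the inclusion of
the polynomial ring into the Laurent polynomial ring is a ring isomorphism. -/
theorem stmt_6 (A : Type*) [CommRing A] (b : Aˣ) :
    ∃ e : (Polynomial A ⧸
            Ideal.span {(Polynomial.X - 1) * (Polynomial.X - Polynomial.C (b : A))}) ≃+*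
          (LaurentPolynomial A ⧸
            Ideal.span {(LaurentPolynomial.T 1 - 1) *
              (LaurentPolynomial.T 1 - LaurentPolynomial.C (b : A))}),
      ∀ p : Polynomial A,
        e (Ideal.Quotient.mk
            (Ideal.span {(Polynomial.X - 1) * (Polynomial.X - Polynomial.C (b : A))}) p)
          = Ideal.Quotient.mk
              (Ideal.span {(LaurentPolynomial.T 1 - 1) *
                (LaurentPolynomial.T 1 - LaurentPolynomial.C (b : A))})
              (Polynomial.toLaurent p) := by
  have hf : toLaurent ((X - 1) * (X - Polynomial.C (b : A))) =
      (T 1 - 1) * (T 1 - LaurentPolynomial.C (b : A)) := by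
    simp
  rw [← hf]
  have h : Ideal.span {(X - 1) * (X - Polynomial.C (b : A))} ≤
      (Ideal.span {toLaurent ((X - 1) * (X - Polynomial.C (b : A)))}).comap toLaurent := by
    rw [Ideal.span_singleton_le_iff_mem]
    exact Ideal.mem_span_singleton_self _
  exact ⟨RingEquiv.ofBijective _
    (bijective_quotientMap_toLaurent (isCoprime_X_mul_X_sub_C b) h), fun _ => rfl⟩
end

section
/- Let S be a commutative ring, let r_1, …, r_n be units of S, and set r_0 = 1, v_i = e_i ∈ ℤ^n for 1 ≤ i ≤ n and v_0 = −(e_1 + ⋯ + e_n) ∈ ℤ^n. In the polynomial ring S[x_0, x_1, …, x_n], let I be the ideal generated by the monomial x_0 x_1 ⋯ x_n together with, for every linear functional u ∈ Hom(ℤ^n, ℤ), the element z_u = ∏_{j: u(v_j) > 0} (1 − x_j)^{u(v_j)} − r_u ∏_{j: u(v_j) < 0} (1 − x_j)^{−u(v_j)}, where r_u = ∏_{i=1}^n r_i^{u(e_i)} (the products over j run over j = 0, 1, …, n). Then I equals the ideal I' of S[x_0, …, x_n] generated by x_0 x_1 ⋯ x_n together with the n elements (1 − x_i) − r_i(1 −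 x_0) for 1 ≤ i ≤ n. -/
lemma Finset.prod_filter_pos_pow_toNat {ι R : Type*} [Fintype ι] [CommMonoid R]
    (f : ι → R) (a : ι → ℤ) :
    ∏ j ∈ Finset.univ.filter (fun j => 0 < a j), f j ^ (a j).toNat
      = ∏ j, f j ^ (a j).toNat := by
  refine Finset.prod_filter_of_ne fun j _ h => ?_
  by_contra! hj
  exact h (by rw [Int.toNat_of_nonpos hj, pow_zero])

/-- If each `f j` is a unit multiple `ρ j * y` of a common element `y`, then the binomial with
exponent vector `a` of total degree zero in the `f j` vanishes. -/
lemma prod_pow_toNat_eq_of_eq_unit_mul {ι R S : Type*} [Fintype ι] [CommRing R] [CommRing S]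
    (φ : S →+* R) (ρ : ι → Sˣ) (y : R) (f : ι → R) (hf : ∀ j, f j = φ (ρ j) * y)
    (a : ι → ℤ) (ha : ∑ j, a j = 0) :
    ∏ j, f j ^ (a j).toNat
      = φ ((∏ j, ρ j ^ a j : Sˣ) : S) * ∏ j, f j ^ (-a j).toNat := by
  have hdeg : ∑ j, (a j).toNat = ∑ j, (-a j).toNat := by
    zify
    rw [← sub_eq_zero, ← Finset.sum_sub_distrib, ← ha]
    exact Finset.sum_congr rfl fun j _ => by omega
  have hunit : ∏ j, ρ j ^ (a j).toNat = (∏ j, ρ j ^ a j) * ∏ j, ρ j ^ (-a j).toNat := by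
    rw [← Finset.prod_mul_distrib]
    refine Finset.prod_congr rfl fun j _ => ?_
    rw [← zpow_natCast, ← zpow_natCast, ← zpow_add]
    congr 1
    omega
  have hexp (e : ι → ℕ) :
      ∏ j, f j ^ e j = φ ((∏ j, ρ j ^ e j : Sˣ) : S) * y ^ ∑ j, e j := by
    simp [hf, mul_pow, Finset.prod_mul_distrib, Finset.prod_pow_eq_pow_sum]
  rw [hexp, hexp, hunit, hdeg, Units.val_mul, map_mul, mul_assoc]

open MvPolynomial in
/-- For the standard `n`-simplex data (`v_i = e_i` for `1 ≤ i ≤ n`,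
`v_0 = -(e_1 + ⋯ + e_n)`, units `r_1,…,r_n` of `S` and `r_0 = 1`), the ideal `I` of
`S[x_0,…,x_n]` generated by `x_0 x_1 ⋯ x_n` together with all the elements
`z_u = ∏_{u(v_j)>0} (1-x_j)^{u(v_j)} - r_u ∏_{u(v_j)<0} (1-x_j)^{-u(v_j)}`
(for `u ∈ Hom(ℤⁿ,ℤ)`, with `r_u = ∏ r_i^{u(e_i)}`) equals the ideal `I'` generated by
`x_0 x_1 ⋯ x_n` together with the `n` elements `(1-x_i) - r_i (1-x_0)`, `1 ≤ i ≤ n`. -/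
theorem stmt_8 (n : ℕ) (S : Type*) [CommRing S] (r : Fin n → Sˣ) :
    -- the characteristic vectors: `v 0 = -(e_1 + ⋯ + e_n)`, `v i.succ = e_i`
    ∀ v : Fin (n + 1) → Fin n → ℤ,
      v = (fun j => Fin.cases (fun _ => (-1 : ℤ)) (fun i => Pi.single i (1 : ℤ)) j) →
    -- `z u` is the element `z_u` associated to the linear functional `u ∈ Hom(ℤⁿ, ℤ)`,
    -- where `u` is identified with its coordinate vector so that `u(v j) = ∑ k, u k * v j k`
    ∀ z : (Fin n → ℤ) → MvPolynomial (Fin (n + 1)) S,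
      z = (fun u =>
        (∏ j ∈ Finset.univ.filter fun j => 0 < ∑ k, u k * v j k,
            (1 - X j) ^ (∑ k, u k * v j k).toNat)
        - C ((∏ i : Fin n, r i ^ u i : Sˣ) : S) *
          ∏ j ∈ Finset.univ.filter fun j => (∑ k, u k * v j k) < 0,
            (1 - X j) ^ (-(∑ k, u k * v j k)).toNat) →
    Ideal.span (insert (∏ j : Fin (n + 1), X j) (Set.range z))
      = Ideal.span (insert (∏ j : Fin (n + 1), X j)
          (Set.range fun i : Fin n =>
            ((1 - X i.succ) - C ((r i : S)) * (1 - X 0) : MvPolynomial (Fin (n + 1)) S))) := by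
  intro v hv z hz
  have hv0 (u : Fin n → ℤ) : ∑ k, u k * v 0 k = -∑ k, u k := by simp [hv]
  have hvs (u : Fin n → ℤ) (i : Fin n) : ∑ k, u k * v i.succ k = u i := by
    simp [hv, Pi.single_apply]
  have hz' (u : Fin n → ℤ) : z u = (∏ j, (1 - X j) ^ (∑ k, u k * v j k).toNat)
      - C ((∏ i : Fin n, r i ^ u i : Sˣ) : S)
        * ∏ j, (1 - X j) ^ (-∑ k, u k * v j k).toNat := by
    simp only [hz, ← Finset.prod_filter_pos_pow_toNat, neg_pos]
  apply le_antisymm <;> rw [Ideal.span_le, Set.insert_subset_iff] <;>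
    refine ⟨Ideal.subset_span (Set.mem_insert _ _), ?_⟩
  · rintro _ ⟨u, rfl⟩
    set I := Ideal.span (insert (∏ j : Fin (n + 1), X j)
      (Set.range fun i : Fin n =>
        ((1 - X i.succ) - C ((r i : S)) * (1 - X 0) : MvPolynomial (Fin (n + 1)) S))) with hI
    have key := prod_pow_toNat_eq_of_eq_unit_mul ((Ideal.Quotient.mk I).comp C)
      (Fin.cons 1 r : Fin (n + 1) → Sˣ) (Ideal.Quotient.mk I (1 - X 0))
      (fun j => Ideal.Quotient.mk I (1 - X j))
      (fun j => by
        refine Fin.cases (by simp) (fun i => ?_) j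
        rw [Fin.cons_succ, RingHom.comp_apply, ← map_mul, Ideal.Quotient.eq]
        exact Ideal.subset_span (Set.mem_insert_of_mem _ ⟨i, rfl⟩))
      (fun j => ∑ k, u k * v j k)
      (by simp only [Fin.sum_univ_succ (n := n), hv0, hvs, neg_add_cancel])
    rw [Fin.prod_univ_succ (fun j => (Fin.cons 1 r : Fin (n + 1) → Sˣ) j ^ _)] at key
    simp only [Fin.cons_zero, one_zpow, one_mul, Fin.cons_succ, hvs, RingHom.comp_apply,
      ← map_pow, ← map_prod, ← map_mul] at key
    rw [SetLike.mem_coe, hz', ← Ideal.Quotient.eq]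
    exact key
  · rintro _ ⟨i, rfl⟩
    refine Ideal.subset_span (Set.mem_insert_of_mem _ ⟨Pi.single i 1, ?_⟩)
    have hpos (j : Fin n) : ((Pi.single i 1 : Fin n → ℤ) j).toNat = if j = i then 1 else 0 := by
      by_cases h : j = i <;> simp [h]
    have hneg (j : Fin n) : (-(Pi.single i 1 : Fin n → ℤ) j).toNat = 0 := by
      by_cases h : j = i <;> simp [h]
    have hr : ∏ j, r j ^ (Pi.single i 1 : Fin n → ℤ) j = r i := by
      rw [Finset.prod_eq_single i] <;> simp +contextual
    rw [hz', hr]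
    simp only [Fin.prod_univ_succ, hv0, hvs, hpos, hneg]
    simp [pow_ite]
end

section
/- Let S be a commutative ring, let r_1, …, r_n be units of S, and set r_0 = 1. Let R = S[x_0, x_1, …, x_n]/I' where I' is the ideal generated by x_0 x_1 ⋯ x_n and the n elements (1 − x_i) − r_i(1 − x_0) for 1 ≤ i ≤ n. Then the S-algebra homomorphism S[x_0, …, x_n] → S[t]/⟨(1 − t)∏_{i=1}^n (1 − r_i t)⟩ sending x_0 ↦ 1 − t and x_i ↦ 1 − r_i t for 1 ≤ i ≤ n descends to a well-defined S-algebra isomorphism R ≅ S[t]/⟨(1 − t)∏_{i=1}^n (1 − r_i t)⟩. -/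
open MvPolynomial in
/-- For units `r_1,…,r_n` of `S` (and `r_0 = 1`), let
`R = S[x_0,…,x_n]/I'` where `I'` is generated by `x_0 x_1 ⋯ x_n` and the elements
`(1 - x_i) - r_i (1 - x_0)`, `1 ≤ i ≤ n`.  The `S`-algebra map sending `x_0 ↦ 1 - t`
and `x_i ↦ 1 - r_i t` descends to an `S`-algebra isomorphism
`R ≅ S[t]/⟨(1 - t) ∏_{i=1}^n (1 - r_i t)⟩`. -/
theorem stmt_9 (n : ℕ) (S : Type*) [CommRing S] (r : Fin n → Sˣ) :
    ∃ e : (MvPolynomial (Fin (n + 1)) S ⧸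
            Ideal.span (insert (∏ j : Fin (n + 1), X j)
              (Set.range fun i : Fin n =>
                ((1 - X i.succ) - C ((r i : S)) * (1 - X 0) : MvPolynomial (Fin (n + 1)) S))))
          ≃ₐ[S]
          (Polynomial S ⧸
            Ideal.span {(1 - Polynomial.X) *
              ∏ i : Fin n, (1 - Polynomial.C ((r i : S)) * Polynomial.X)}),
      (e (Ideal.Quotient.mk
            (Ideal.span (insert (∏ j : Fin (n + 1), X j)
              (Set.range fun i : Fin n =>
                ((1 - X i.succ) - C ((r i : S)) * (1 - X 0) : MvPolynomial (Fin (n + 1)) S))))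
            (X 0))
        = Ideal.Quotient.mk
            (Ideal.span {(1 - Polynomial.X) *
              ∏ i : Fin n, (1 - Polynomial.C ((r i : S)) * Polynomial.X)})
            (1 - Polynomial.X)) ∧
      ∀ i : Fin n,
        e (Ideal.Quotient.mk
            (Ideal.span (insert (∏ j : Fin (n + 1), X j)
              (Set.range fun i : Fin n =>
                ((1 - X i.succ) - C ((r i : S)) * (1 - X 0) : MvPolynomial (Fin (n + 1)) S))))
            (X i.succ))
        = Ideal.Quotient.mk
            (Ideal.span {(1 - Polynomial.X) *
              ∏ i : Fin n, (1 - Polynomial.C ((r i : S)) * Polynomial.X)})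
            (1 - Polynomial.C ((r i : S)) * Polynomial.X) := by
  have hφ : Ideal.span (insert (∏ j : Fin (n + 1), X j)
      (Set.range fun i : Fin n =>
        ((1 - X i.succ) - C ((r i : S)) * (1 - X 0) : MvPolynomial (Fin (n + 1)) S))) ≤
      (Ideal.span {(1 - Polynomial.X) *
        ∏ i : Fin n, (1 - Polynomial.C ((r i : S)) * Polynomial.X)}).comap
        (aeval (Fin.cons (1 - Polynomial.X)
          fun i => 1 - Polynomial.C ((r i : S)) * Polynomial.X)) := by
    rw [Ideal.span_le, Set.insert_subset_iff, Set.range_subset_iff]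
    refine ⟨?_, fun i => ?_⟩
    · simp [Fin.prod_univ_succ]
    · simp
  have hX : ∀ i : Fin n, Ideal.Quotient.mk
      (Ideal.span (insert (∏ j : Fin (n + 1), X j)
        (Set.range fun i : Fin n =>
          ((1 - X i.succ) - C ((r i : S)) * (1 - X 0) : MvPolynomial (Fin (n + 1)) S))))
      (1 - C ((r i : S)) * (1 - X 0)) = Ideal.Quotient.mk _ (X i.succ) := fun i => by
    refine Ideal.Quotient.eq.mpr ?_
    rw [sub_right_comm]
    exact Ideal.subset_span (Set.mem_insert_of_mem _ (Set.mem_range_self i))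
  have hψ : Ideal.span {(1 - Polynomial.X) *
        ∏ i : Fin n, (1 - Polynomial.C ((r i : S)) * Polynomial.X)} ≤
      (Ideal.span (insert (∏ j : Fin (n + 1), X j)
        (Set.range fun i : Fin n =>
          ((1 - X i.succ) - C ((r i : S)) * (1 - X 0) :
            MvPolynomial (Fin (n + 1)) S)))).comap
        (Polynomial.aeval (1 - X 0 : MvPolynomial (Fin (n + 1)) S)) := by
    rw [Ideal.span_singleton_le_iff_mem, Ideal.mem_comap, ← Ideal.Quotient.eq_zero_iff_mem]
    simp only [map_mul, map_prod, map_sub, map_one, Polynomial.aeval_X, Polynomial.aeval_C,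
      sub_sub_cancel, algebraMap_eq] at hX ⊢
    rw [Finset.prod_congr rfl fun i _ => hX i, ← map_prod, ← map_mul, ← Fin.prod_univ_succ]
    exact Ideal.Quotient.eq_zero_iff_mem.mpr (Ideal.subset_span (Set.mem_insert _ _))
  refine ⟨AlgEquiv.ofAlgHom (Ideal.quotientMapₐ _ _ hφ) (Ideal.quotientMapₐ _ _ hψ) ?_ ?_,
    ?_, fun i => ?_⟩
  · refine Ideal.Quotient.algHom_ext _ (Polynomial.algHom_ext ?_)
    simp
  · refine Ideal.Quotient.algHom_ext _ (MvPolynomial.algHom_ext fun j => ?_)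
    refine Fin.cases ?_ (fun i => ?_) j
    · simp
    · simpa [← Ideal.Quotient.mk_algebraMap, algebraMap_eq] using hX i
  · simp
  · simp
end

section
/- Let S be a commutative ring, set r_0 = 1, and let r_1, …, r_n be units of S. Let t̄ denote the image of t in A = S[t]/⟨∏_{i=0}^{n} (1 − r_i t)⟩, which is a unit of A. Then the S-algebra homomorphism S[y] → A sending y to t̄^{−1} descends to a well-defined S-algebra isomorphism S[y]/⟨∏_{i=0}^{n} (y − r_i)⟩ ≅ S[t]/⟨∏_{i=0}^{n} (1 − r_i t)⟩. -/
/-- If `∏ i, (a i + b i * x) = 0` with all `a i` units, then `x` is a unit. -/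
theorem isUnit_of_prod_add_mul_eq_zero {ι A : Type*} [CommRing A] (s : Finset ι) (a b : ι → A)
    (x : A) (ha : ∀ i ∈ s, IsUnit (a i)) (h : ∏ i ∈ s, (a i + b i * x) = 0) : IsUnit x := by
  have hx : Ideal.Quotient.mk (Ideal.span {x}) x = 0 :=
    Ideal.Quotient.eq_zero_iff_mem.2 (Ideal.mem_span_singleton_self x)
  have h' := congrArg (Ideal.Quotient.mk (Ideal.span {x})) h
  simp only [map_prod, map_add, map_mul, hx, mul_zero, add_zero, map_zero] at h'
  rw [← map_prod, Ideal.Quotient.eq_zero_iff_mem, Ideal.mem_span_singleton] at h'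
  exact isUnit_of_dvd_unit h' ((IsUnit.prod_iff).2 ha)

theorem prod_sub_mul_pow_card {ι A : Type*} [CommRing A] (s : Finset ι) (r : ι → A) {x y : A}
    (h : y * x = 1) : (∏ i ∈ s, (y - r i)) * x ^ s.card = ∏ i ∈ s, (1 - r i * x) := by
  rw [← Finset.prod_const, ← Finset.prod_mul_distrib]
  exact Finset.prod_congr rfl fun i _ => by rw [sub_mul, h]

theorem prod_sub_eq_zero_iff {ι A : Type*} [CommRing A] (s : Finset ι) (r : ι → A) {x y : A}
    (h : y * x = 1) : ∏ i ∈ s, (y - r i) = 0 ↔ ∏ i ∈ s, (1 - r i * x) = 0 := by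
  rw [← prod_sub_mul_pow_card s r h]
  exact (((IsUnit.of_mul_eq_one_right y h).pow _).mul_left_eq_zero).symm

/-- For units `r_0 = 1, r_1, …, r_n` of a commutative ring `S`, the `S`-algebra
homomorphism `S[y] → A = S[t]/⟨∏_{i=0}^{n} (1 - r_i t)⟩` sending `y` to the inverse `t̄⁻¹` of
the (unit) image `t̄` of `t` descends to an `S`-algebra isomorphism
`S[y]/⟨∏_{i=0}^{n} (y - r_i)⟩ ≅ A`.  The condition `e(ȳ) * t̄ = 1` expresses that the
isomorphism sends `ȳ` to `t̄⁻¹`. -/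
theorem stmt_11 (n : ℕ) (S : Type*) [CommRing S] (r : Fin (n + 1) → Sˣ) (h0 : r 0 = 1) :
    ∃ e : (Polynomial S ⧸
            Ideal.span {∏ i : Fin (n + 1), (Polynomial.X - Polynomial.C ((r i : S)))})
          ≃ₐ[S]
          (Polynomial S ⧸
            Ideal.span {∏ i : Fin (n + 1), (1 - Polynomial.C ((r i : S)) * Polynomial.X)}),
      e (Ideal.Quotient.mk
            (Ideal.span {∏ i : Fin (n + 1), (Polynomial.X - Polynomial.C ((r i : S)))})
            Polynomial.X) *
        Ideal.Quotient.mk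
            (Ideal.span {∏ i : Fin (n + 1), (1 - Polynomial.C ((r i : S)) * Polynomial.X)})
            Polynomial.X = 1 := by
  set p : Polynomial S := ∏ i : Fin (n + 1), (Polynomial.X - Polynomial.C ((r i : S))) with hp
  set q : Polynomial S := ∏ i : Fin (n + 1), (1 - Polynomial.C ((r i : S)) * Polynomial.X) with hq
  set x := Ideal.Quotient.mk (Ideal.span {p}) Polynomial.X
  set t := Ideal.Quotient.mk (Ideal.span {q}) Polynomial.X
  have hC (f : Polynomial S) (s : S) : Ideal.Quotient.mk (Ideal.span {f}) (Polynomial.C s) =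
      algebraMap S (Polynomial S ⧸ Ideal.span {f}) s := rfl
  have hp0 : ∏ i, (x - algebraMap S _ (r i : S)) = 0 := by
    have h := (congrArg (Ideal.Quotient.mk (Ideal.span {p})) hp).symm.trans
      (Ideal.Quotient.eq_zero_iff_mem.2 (Ideal.mem_span_singleton_self p))
    simpa only [map_prod, map_sub, hC] using h
  have hq0 : ∏ i, (1 - algebraMap S _ (r i : S) * t) = 0 := by
    have h := (congrArg (Ideal.Quotient.mk (Ideal.span {q})) hq).symm.trans
      (Ideal.Quotient.eq_zero_iff_mem.2 (Ideal.mem_span_singleton_self q))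
    simpa only [map_prod, map_sub, map_mul, map_one, hC] using h
  obtain ⟨x', hx'⟩ : ∃ x', x * x' = 1 := by
    refine (isUnit_of_prod_add_mul_eq_zero Finset.univ
      (fun i => -algebraMap S _ (r i : S)) (fun _ => 1) x
      (fun i _ => ((r i).isUnit.map _).neg) ?_).exists_right_inv
    simpa only [one_mul, neg_add_eq_sub] using hp0
  obtain ⟨t', ht'⟩ : ∃ t', t' * t = 1 := by
    refine (isUnit_of_prod_add_mul_eq_zero Finset.univ
      (fun _ => 1) (fun i => -algebraMap S _ (r i : S)) t
      (fun _ _ => isUnit_one) ?_).exists_left_inv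
    exact (Finset.prod_congr rfl fun i _ => by ring).trans hq0
  have hp1 : Polynomial.aeval t' p = 0 := by
    simpa only [hp, map_prod, map_sub, Polynomial.aeval_X, Polynomial.aeval_C] using
      (prod_sub_eq_zero_iff _ _ ht').2 hq0
  have hq1 : Polynomial.aeval x' q = 0 := by
    simpa only [hq, map_prod, map_sub, map_mul, map_one, Polynomial.aeval_X,
      Polynomial.aeval_C] using (prod_sub_eq_zero_iff _ _ hx').1 hp0
  have lift_zero {B : Type _} [CommRing B] [Algebra S B] {f : Polynomial S} {b : B}
      (h : Polynomial.aeval b f = 0) : ∀ a ∈ Ideal.span {f}, Polynomial.aeval b a = 0 := by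
    intro a ha
    obtain ⟨c, rfl⟩ := Ideal.mem_span_singleton.1 ha
    rw [map_mul, h, zero_mul]
  let F := Ideal.Quotient.liftₐ (Ideal.span {p}) (Polynomial.aeval t') (lift_zero hp1)
  let G := Ideal.Quotient.liftₐ (Ideal.span {q}) (Polynomial.aeval x') (lift_zero hq1)
  have hF : F x = t' := Polynomial.aeval_X t'
  have hG : G t = x' := Polynomial.aeval_X x'
  have hFx' : F x' = t := by
    have h : t' * F x' = 1 := by rw [← hF, ← map_mul, hx', map_one]
    exact (left_inv_eq_right_inv ((mul_comm _ _).trans ht') h).symm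
  have hGt' : G t' = x := by
    have h : G t' * x' = 1 := by rw [← hG, ← map_mul, ht', map_one]
    exact left_inv_eq_right_inv h ((mul_comm _ _).trans hx')
  refine ⟨AlgEquiv.ofAlgHom F G ?_ ?_, ?_⟩
  · refine Ideal.Quotient.algHom_ext _ (Polynomial.algHom_ext ?_)
    change F (G t) = t
    rw [hG, hFx']
  · refine Ideal.Quotient.algHom_ext _ (Polynomial.algHom_ext ?_)
    change G (F x) = x
    rw [hF, hGt']
  · change F x * t = 1
    rw [hF, ht']
end

section
/- Let R be a commutative ring, let M be an R-module generated by n elements, and let f : M → R^n be a surjective R-linear map onto the free R-module of rank n. Then f is injective, hence an isomorphism of R-modules. -/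
/-- If `M` is an `R`-module generated by `n` elements and `f : M → Rⁿ`
is a surjective `R`-linear map onto the free module of rank `n`, then `f` is injective
(hence an isomorphism). -/
theorem stmt_12 (R : Type*) [CommRing R] (M : Type*) [AddCommGroup M] [Module R M]
    (n : ℕ) (m : Fin n → M) (hgen : Submodule.span R (Set.range m) = ⊤)
    (f : M →ₗ[R] (Fin n → R)) (hf : Function.Surjective f) :
    Function.Injective f := by
  have hg : Function.Surjective (Fintype.linearCombination R m) := by
    rw [← LinearMap.range_eq_top, Fintype.range_linearCombination, hgen]
  have hfg : Function.Injective (f ∘ₗ Fintype.linearCombination R m) :=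
    OrzechProperty.injective_of_surjective_endomorphism _ (hf.comp hg)
  exact Function.Injective.of_comp_right hfg hg
end
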